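/- arXiv:cond-mat/0202356 — 6 statements merged into one kernel-verified Lean document; each statement's English description precedes it below -/
import Mathlib

section
/- Let Y and ε be independent real random variables on a probability space (Ω, 𝒜, ℙ), let β > 0 be a constant and set X = β·Y + ε. Assume: (H0) F_Y(y) < 1 for every real y and F_X(x) < 1 for every real x; Y has a probability density P_Y with respect to Lebesgue measure (so F_Y is continuous); the function y ↦ y·P_Y(y)/F̄_Y(y) is bounded above on (0, ∞); (H1) there is a function f on [1, ∞) such that for every x ≥ 1, lim_{t→∞} t·P_Y(t·x)/F̄_Y(t) = f(x); (H2) there exist t₀ > 0, δ > 0 and A > 0 such that for all t ≥ t₀ and all x ≥ 1, F̄_Y(t·x)/F̄_Y(t) ≤ A·x^{−δ}; (H3) lim_{u→1⁻} F_X⁻¹(u)/F_Y⁻¹(u) = l with l > 0. Then the coefficient of upper tail dependence λ₊ = lim_{u→1⁻} ℙ(X > F_X⁻¹(u) | Y > F_Y⁻¹(u)) exists and equals ∫_{max{1, l/β}}^{∞} f(x) dx. -/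
open MeasureTheory ProbabilityTheory Filter Set Topology

/-- Cumulative distribution function of a real random variable. -/
noncomputable def cdf' {Ω : Type*} [MeasureSpace Ω] (Z : Ω → ℝ) (z : ℝ) : ℝ :=
  (ℙ {ω | Z ω ≤ z}).toReal

/-- Survival function `F̄_Z = 1 - F_Z`. -/
noncomputable def surv {Ω : Type*} [MeasureSpace Ω] (Z : Ω → ℝ) (z : ℝ) : ℝ :=
  1 - cdf' Z z

/-- Generalized inverse (quantile function) `F_Z⁻¹(u) = inf {z | F_Z z ≥ u}`. -/
noncomputable def quant {Ω : Type*} [MeasureSpace Ω] (Z : Ω → ℝ) (u : ℝ) : ℝ :=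
  sInf {z : ℝ | u ≤ cdf' Z z}

/-- Conditional probability `ℙ(A | B)`. -/
noncomputable def condP {Ω : Type*} [MeasureSpace Ω] (A B : Set Ω) : ℝ :=
  (ℙ (A ∩ B)).toReal / (ℙ B).toReal

section helpers
variable {Ω : Type*} [MeasureSpace Ω] [IsProbabilityMeasure (ℙ : Measure Ω)]

lemma surv_eq_real (Z : Ω → ℝ) (hZ : Measurable Z) (z : ℝ) :
    surv Z z = (ℙ : Measure Ω).real {ω | z < Z ω} := by
  have h : {ω | z < Z ω} = {ω | Z ω ≤ z}ᶜ := by ext ω; simp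
  have hm : MeasurableSet {ω | Z ω ≤ z} := measurableSet_le hZ measurable_const
  rw [h, probReal_compl_eq_one_sub hm]
  rfl

lemma cdf'_eq (Z : Ω → ℝ) (hZ : Measurable Z) (z : ℝ) :
    cdf' Z z = cdf (Measure.map Z ℙ) z := by
  haveI : IsProbabilityMeasure (Measure.map Z (ℙ : Measure Ω)) :=
    Measure.isProbabilityMeasure_map hZ.aemeasurable
  rw [cdf_eq_real, measureReal_def, Measure.map_apply hZ measurableSet_Iic]
  rfl

lemma surv_tendsto_top (Z : Ω → ℝ) (hZ : Measurable Z) :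
    Tendsto (surv Z) atTop (𝓝 0) := by
  have h := (tendsto_cdf_atTop (Measure.map Z (ℙ : Measure Ω)))
  have h2 := h.const_sub 1
  rw [sub_self] at h2
  refine h2.congr fun z => ?_
  rw [surv, cdf'_eq Z hZ]

lemma surv_tendsto_bot (Z : Ω → ℝ) (hZ : Measurable Z) :
    Tendsto (surv Z) atBot (𝓝 1) := by
  have h := (tendsto_cdf_atBot (Measure.map Z (ℙ : Measure Ω)))
  have h2 := h.const_sub 1
  rw [sub_zero] at h2
  refine h2.congr fun z => ?_
  rw [surv, cdf'_eq Z hZ]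

lemma quant_tendsto (Z : Ω → ℝ) (hZ : Measurable Z) (hF : ∀ y, cdf' Z y < 1) :
    Tendsto (quant Z) (𝓝[<] (1:ℝ)) atTop := by
  rw [tendsto_atTop]
  intro b
  have h1 : ∀ᶠ u in 𝓝[<] (1:ℝ), cdf' Z b < u :=
    nhdsWithin_le_nhds (lt_mem_nhds (hF b))
  filter_upwards [h1, self_mem_nhdsWithin] with u hu hu1
  have hu1' : u < 1 := hu1
  have hT : Tendsto (cdf' Z) atTop (𝓝 1) :=
    (tendsto_cdf_atTop (Measure.map Z (ℙ : Measure Ω))).congr fun z => (cdf'_eq Z hZ z).symm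
  obtain ⟨z, hz⟩ := (hT.eventually (lt_mem_nhds hu1')).exists
  refine le_csInf ⟨z, hz.le⟩ ?_
  intro w hw
  by_contra hlt
  push Not at hlt
  have hmono : cdf' Z w ≤ cdf' Z b := by
    rw [cdf'_eq Z hZ, cdf'_eq Z hZ]; exact monotone_cdf _ hlt.le
  have hw' : u ≤ cdf' Z w := hw
  linarith

lemma surv_integral (Y : Ω → ℝ) (hYm : Measurable Y)
    (P_Y : ℝ → ℝ) (hPm : Measurable P_Y) (hPnn : ∀ y, 0 ≤ P_Y y)
    (hdens : Measure.map Y ℙ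
      = (volume : Measure ℝ).withDensity (fun y => ENNReal.ofReal (P_Y y))) (z : ℝ) :
    surv Y z = ∫ y in Ioi z, P_Y y := by
  rw [surv_eq_real Y hYm, integral_eq_lintegral_of_nonneg_ae (ae_of_all _ hPnn)
    hPm.aestronglyMeasurable, ← withDensity_apply _ measurableSet_Ioi, ← hdens,
    Measure.map_apply hYm measurableSet_Ioi]
  rfl

lemma ratio_facts (Y : Ω → ℝ) (hYm : Measurable Y) (hFY : ∀ y : ℝ, cdf' Y y < 1)
    (P_Y : ℝ → ℝ) (hPm : Measurable P_Y) (hPnn : ∀ y, 0 ≤ P_Y y)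
    (hdens : Measure.map Y ℙ
      = (volume : Measure ℝ).withDensity (fun y => ENNReal.ofReal (P_Y y)))
    (hbdd : ∃ M : ℝ, ∀ y > (0:ℝ), y * P_Y y / surv Y y ≤ M)
    (f : ℝ → ℝ)
    (hH1 : ∀ x ≥ (1:ℝ), Tendsto (fun t => t * P_Y (t * x) / surv Y t) atTop (𝓝 (f x)))
    (hH2 : ∃ t₀ > (0:ℝ), ∃ δ > (0:ℝ), ∃ A > (0:ℝ),
      ∀ t ≥ t₀, ∀ x ≥ (1:ℝ), surv Y (t * x) / surv Y t ≤ A * x ^ (-δ)) :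
    IntegrableOn f (Ioi 1) ∧ ∀ c ≥ (1:ℝ), Tendsto (fun t => surv Y (t * c) / surv Y t) atTop
      (𝓝 (∫ x in Ioi c, f x)) := by
  obtain ⟨M, hM⟩ := hbdd
  obtain ⟨t₀, ht₀, δ, hδ, A, hA, hH⟩ := hH2
  have hpos : ∀ y, 0 < surv Y y := fun y => by have := hFY y; unfold surv; linarith
  have hb : ∀ t ≥ t₀, ∀ x ≥ (1:ℝ), ‖t * P_Y (t * x) / surv Y t‖ ≤ M * A * x ^ (-δ - 1) := by
    intro t ht x hx
    have htp : 0 < t := lt_of_lt_of_le ht₀ ht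
    have hxp : 0 < x := by linarith
    rw [Real.norm_of_nonneg (div_nonneg (mul_nonneg htp.le (hPnn _)) (hpos t).le)]
    have h1 := hM (t * x) (by positivity)
    have h2 := hH t ht x hx
    have h0 : 0 ≤ t * x * P_Y (t * x) / surv Y (t * x) :=
      div_nonneg (mul_nonneg (by positivity) (hPnn _)) (hpos _).le
    have h3 : t * P_Y (t * x) / surv Y t
        = (t * x * P_Y (t * x) / surv Y (t * x)) * (surv Y (t * x) / surv Y t) * x⁻¹ := by
      have := (hpos t).ne'
      have := (hpos (t * x)).ne'
      field_simp
    have h4 : M * A * x ^ (-δ - 1) = M * (A * x ^ (-δ)) * x⁻¹ := by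
      rw [Real.rpow_sub_one hxp.ne']
      ring
    rw [h3, h4]
    refine mul_le_mul_of_nonneg_right ?_ (by positivity)
    exact mul_le_mul h1 h2 (div_nonneg (hpos _).le (hpos _).le) (h0.trans h1)
  have hbi : ∀ c ≥ (1:ℝ), IntegrableOn (fun x : ℝ => M * A * x ^ (-δ - 1)) (Ioi c) := by
    intro c hc
    exact (integrableOn_Ioi_rpow_of_lt (by linarith) (by linarith)).const_mul _
  have hmeas : ∀ t, Measurable (fun x => t * P_Y (t * x) / surv Y t) := fun t => by fun_prop
  constructor
  · refine Integrable.mono' (hbi 1 le_rfl) ?_ ?_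
    · refine aestronglyMeasurable_of_tendsto_ae atTop (fun t => (hmeas t).aestronglyMeasurable) ?_
      filter_upwards [ae_restrict_mem measurableSet_Ioi] with x hx
      exact hH1 x (le_of_lt hx)
    · filter_upwards [ae_restrict_mem measurableSet_Ioi] with x hx
      refine le_of_tendsto (hH1 x (le_of_lt hx)).norm ?_
      filter_upwards [eventually_ge_atTop t₀] with t ht
      exact hb t ht x (le_of_lt hx)
  · intro c hc
    have key : Tendsto (fun t => ∫ x in Ioi c, t * P_Y (t * x) / surv Y t) atTop
        (𝓝 (∫ x in Ioi c, f x)) := by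
      refine tendsto_integral_filter_of_dominated_convergence _
        (Eventually.of_forall fun t => (hmeas t).aestronglyMeasurable) ?_ (hbi c hc) ?_
      · filter_upwards [eventually_ge_atTop t₀] with t ht
        filter_upwards [ae_restrict_mem measurableSet_Ioi] with x hx
        exact hb t ht x (hc.trans (le_of_lt hx))
      · filter_upwards [ae_restrict_mem measurableSet_Ioi] with x hx
        exact hH1 x (hc.trans (le_of_lt hx))
    refine key.congr' ?_
    filter_upwards [eventually_gt_atTop 0] with t ht
    rw [integral_div, integral_const_mul, integral_comp_mul_left_Ioi _ _ ht,
      ← surv_integral Y hYm P_Y hPm hPnn hdens]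
    rw [smul_eq_mul, ← mul_assoc, mul_inv_cancel₀ ht.ne', one_mul]

end helpers

/-- Tail dependence of factor models: main theorem.
`λ₊ = lim_{u→1⁻} ℙ(X > F_X⁻¹(u) | Y > F_Y⁻¹(u))` exists and equals
`∫_{max{1, l/β}}^∞ f(x) dx`. -/
theorem tail_dependence_factor_model
    {Ω : Type*} [MeasureSpace Ω] [IsProbabilityMeasure (ℙ : Measure Ω)]
    (Y ε X : Ω → ℝ) (hYm : Measurable Y) (hεm : Measurable ε)
    (hindep : IndepFun Y ε ℙ)
    (β : ℝ) (hβ : 0 < β)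
    (hXdef : ∀ ω, X ω = β * Y ω + ε ω)
    (hFY : ∀ y : ℝ, cdf' Y y < 1) (hFX : ∀ x : ℝ, cdf' X x < 1)
    (P_Y : ℝ → ℝ) (hPm : Measurable P_Y) (hPnn : ∀ y, 0 ≤ P_Y y)
    (hdens : Measure.map Y ℙ
      = (volume : Measure ℝ).withDensity (fun y => ENNReal.ofReal (P_Y y)))
    (hbdd : ∃ M : ℝ, ∀ y > (0:ℝ), y * P_Y y / surv Y y ≤ M)
    (f : ℝ → ℝ)
    (hH1 : ∀ x ≥ (1:ℝ), Tendsto (fun t => t * P_Y (t * x) / surv Y t) atTop (𝓝 (f x)))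
    (hH2 : ∃ t₀ > (0:ℝ), ∃ δ > (0:ℝ), ∃ A > (0:ℝ),
      ∀ t ≥ t₀, ∀ x ≥ (1:ℝ), surv Y (t * x) / surv Y t ≤ A * x ^ (-δ))
    (l : ℝ) (hl : 0 < l)
    (hH3 : Tendsto (fun u => quant X u / quant Y u) (𝓝[<] (1:ℝ)) (𝓝 l)) :
    Tendsto (fun u => condP {ω | quant X u < X ω} {ω | quant Y u < Y ω})
      (𝓝[<] (1:ℝ)) (𝓝 (∫ x in Ici (max 1 (l / β)), f x)) := by
  obtain ⟨hfi, hrat⟩ := ratio_facts Y hYm hFY P_Y hPm hPnn hdens hbdd f hH1 hH2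
  have hpos : ∀ y, 0 < surv Y y := fun y => by have := hFY y; unfold surv; linarith
  have hq := quant_tendsto Y hYm hFY
  rw [integral_Ici_eq_integral_Ioi]
  set h : ℝ → ℝ := fun c => ∫ x in Ioi c, f x with hh
  set c := max 1 (l / β) with hc
  have hc1 : 1 ≤ c := le_max_left _ _
  have hcont : ContinuousOn h (Icc 1 (c + 1)) := by
    have hI : ContinuousOn (fun x => ∫ y in Ioc 1 x, f y) (Icc 1 (c + 1)) :=
      intervalIntegral.continuousOn_primitive
        ((integrableOn_Icc_iff_integrableOn_Ioc).2 (hfi.mono_set Ioc_subset_Ioi_self))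
    have h2 : ContinuousOn (fun x => (∫ y in Ioi 1, f y) - ∫ y in Ioc 1 x, f y) (Icc 1 (c + 1)) :=
      continuousOn_const.sub hI
    refine h2.congr fun x hx => ?_
    have h3 := setIntegral_union (μ := volume) (f := f) (Ioc_disjoint_Ioi_same (a := (1:ℝ)) (b := x))
      measurableSet_Ioi (hfi.mono_set Ioc_subset_Ioi_self)
      (hfi.mono_set (Ioi_subset_Ioi hx.1))
    rw [Ioc_union_Ioi_eq_Ioi hx.1] at h3
    simp only [hh]
    linarith
  have hcc := hcont c ⟨hc1, by linarith⟩
  have hden : ∀ u, (ℙ {ω | quant Y u < Y ω}).toReal = surv Y (quant Y u) := fun u =>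
    (surv_eq_real Y hYm _).symm
  have hprod : ∀ a b : ℝ, (ℙ : Measure Ω).real ({ω | a < Y ω} ∩ {ω | b < ε ω})
      = surv Y a * surv ε b := by
    intro a b
    rw [surv_eq_real Y hYm, surv_eq_real ε hεm, measureReal_def, measureReal_def, measureReal_def,
      ← ENNReal.toReal_mul]
    congr 1
    exact hindep.measure_inter_preimage_eq_mul _ _ measurableSet_Ioi measurableSet_Ioi
  have hlim : ∀ c' : ℝ, Tendsto (fun u => quant X u / quant Y u - β * c') (𝓝[<] (1:ℝ))
      (𝓝 (l - β * c')) := fun c' => hH3.sub_const _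
  have hqeq : ∀ c' : ℝ, ∀ᶠ u in 𝓝[<] (1:ℝ), quant Y u * (quant X u / quant Y u - β * c')
      = quant X u - β * (quant Y u * c') := by
    intro c'
    filter_upwards [hq.eventually (eventually_gt_atTop 0)] with u hu
    field_simp
  have hle1 : l / β ≤ c := le_max_right _ _
  rw [tendsto_order]
  constructor
  · intro a ha
    have hev : ∀ᶠ c' in 𝓝[Ioo c (c + 1)] c, a < h c' :=
      (hcc.mono (fun x hx => ⟨hc1.trans hx.1.le, hx.2.le⟩)).eventually (lt_mem_nhds ha)
    rw [nhdsWithin_Ioo_eq_nhdsGT (by linarith)] at hev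
    obtain ⟨c', hac', hcc'⟩ := (hev.and self_mem_nhdsWithin).exists
    have hcc' : c < c' := hcc'
    have hneg : l - β * c' < 0 := by
      have : l / β < c' := lt_of_le_of_lt hle1 hcc'
      rw [div_lt_iff₀ hβ] at this
      linarith
    have hbot : Tendsto (fun u => quant X u - β * (quant Y u * c')) (𝓝[<] (1:ℝ)) atBot :=
      (hq.atTop_mul_neg hneg (hlim c')).congr' (hqeq c')
    have hT : Tendsto (fun u => surv Y (quant Y u * c') / surv Y (quant Y u)
        * surv ε (quant X u - β * (quant Y u * c'))) (𝓝[<] (1:ℝ)) (𝓝 (h c' * 1)) :=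
      ((hrat c' (hc1.trans hcc'.le)).comp hq).mul ((surv_tendsto_bot ε hεm).comp hbot)
    rw [mul_one] at hT
    filter_upwards [hT.eventually (lt_mem_nhds hac'), hq.eventually (eventually_gt_atTop 0)]
      with u hu hu0
    refine hu.trans_le ?_
    rw [condP, hden, div_mul_eq_mul_div]
    refine div_le_div_of_nonneg_right ?_ (hpos _).le
    rw [← hprod]
    refine measureReal_mono ?_
    rintro ω ⟨h1, h2⟩
    simp only [mem_setOf_eq, mem_inter_iff] at h1 h2 ⊢
    rw [hXdef]
    constructor
    · have := mul_lt_mul_of_pos_left h1 hβ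
      linarith
    · have : quant Y u * 1 ≤ quant Y u * c' :=
        mul_le_mul_of_nonneg_left (hc1.trans hcc'.le) hu0.le
      linarith
  · intro a ha
    rcases le_or_gt (l / β) 1 with hl1 | hl1
    · have hceq : c = 1 := max_eq_left hl1
      have h1 : h 1 = 1 := by
        refine tendsto_nhds_unique (hrat 1 le_rfl) ?_
        refine tendsto_const_nhds.congr fun t => ?_
        rw [mul_one, div_self (hpos t).ne']
      refine Eventually.of_forall fun u => lt_of_le_of_lt ?_ ha
      change _ ≤ h c
      rw [hceq, h1, condP]
      refine div_le_one_of_le₀ ?_ ENNReal.toReal_nonneg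
      exact measureReal_mono (μ := (ℙ : Measure Ω)) inter_subset_right
    · have hceq : c = l / β := max_eq_right hl1.le
      have hev : ∀ᶠ c' in 𝓝[Ioo 1 c] c, h c' < a :=
        (hcc.mono (fun x hx => ⟨hx.1.le, by have := hx.2; linarith⟩)).eventually (gt_mem_nhds ha)
      have hc1' : 1 < c := hceq ▸ hl1
      rw [nhdsWithin_Ioo_eq_nhdsLT hc1'] at hev
      obtain ⟨c', ⟨hac', hcc'⟩, h1c'⟩ := ((hev.and self_mem_nhdsWithin).and
        (nhdsWithin_le_nhds (lt_mem_nhds hc1'))).exists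
      have hcc' : c' < c := hcc'
      have hps : 0 < l - β * c' := by
        rw [hceq, lt_div_iff₀ hβ] at hcc'
        linarith
      have htop : Tendsto (fun u => quant X u - β * (quant Y u * c')) (𝓝[<] (1:ℝ)) atTop :=
        (hq.atTop_mul_pos hps (hlim c')).congr' (hqeq c')
      have hT : Tendsto (fun u => surv Y (quant Y u * c') / surv Y (quant Y u)
          + surv ε (quant X u - β * (quant Y u * c'))) (𝓝[<] (1:ℝ)) (𝓝 (h c' + 0)) :=
        ((hrat c' h1c'.le).comp hq).add ((surv_tendsto_top ε hεm).comp htop)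
      rw [add_zero] at hT
      filter_upwards [hT.eventually (gt_mem_nhds hac')] with u hu
      refine lt_of_le_of_lt ?_ hu
      rw [condP, hden, div_le_iff₀ (hpos _), add_mul, div_mul_cancel₀ _ (hpos _).ne',
        mul_comm (surv ε _), ← hprod, surv_eq_real Y hYm]
      refine le_trans (measureReal_mono (μ := (ℙ : Measure Ω)) ?_) (measureReal_union_le _ _)
      rintro ω ⟨h1, h2⟩
      simp only [mem_setOf_eq, mem_inter_iff, mem_union] at h1 h2 ⊢
      rw [hXdef] at h1
      by_cases h3 : quant Y u * c' < Y ω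
      · exact Or.inl h3
      · push Not at h3
        refine Or.inr ⟨h2, ?_⟩
        have := mul_le_mul_of_nonneg_left h3 hβ.le
        linarith
end

section
/- Let Y and ε be independent real random variables on a probability space (Ω, 𝒜, ℙ), let β > 0 and set X = β·Y + ε. Assume Y has a probability density P_Y with respect to Lebesgue measure (so F_Y is continuous). Then for every u ∈ (0, 1) such that F_Y⁻¹(u) > 0, one has ℙ(X > F_X⁻¹(u) | Y > F_Y⁻¹(u)) = (F_Y⁻¹(u)/(1 − u)) · ∫_{1}^{∞} P_Y(F_Y⁻¹(u)·x) · F̄_ε(F_X⁻¹(u) − β·F_Y⁻¹(u)·x) dx. -/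
open MeasureTheory ProbabilityTheory Filter Set Topology

lemma aux_cdf {Ω : Type*} [MeasureSpace Ω] [IsProbabilityMeasure (ℙ : Measure Ω)]
    (Z : Ω → ℝ) (hZ : Measurable Z) (z : ℝ) : cdf' Z z = cdf (Measure.map Z ℙ) z := by
  have := Measure.isProbabilityMeasure_map (μ := (ℙ : Measure Ω)) hZ.aemeasurable
  rw [cdf_eq_real, measureReal_def, Measure.map_apply hZ measurableSet_Iic]
  rfl

lemma aux_surv {Ω : Type*} [MeasureSpace Ω] [IsProbabilityMeasure (ℙ : Measure Ω)]
    (Z : Ω → ℝ) (hZ : Measurable Z) (z : ℝ) :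
    surv Z z = ((Measure.map Z ℙ) (Ioi z)).toReal := by
  have := Measure.isProbabilityMeasure_map (μ := (ℙ : Measure Ω)) hZ.aemeasurable
  have h := probReal_compl_eq_one_sub (μ := Measure.map Z ℙ) (measurableSet_Iic (a := z))
  rw [compl_Iic] at h
  rw [surv, aux_cdf Z hZ, cdf_eq_real, ← h]
  rfl

lemma aux_quant {Ω : Type*} [MeasureSpace Ω] [IsProbabilityMeasure (ℙ : Measure Ω)]
    (Z : Ω → ℝ) (hZ : Measurable Z) (hna : ∀ z, (Measure.map Z ℙ) {z} = 0)
    (u : ℝ) (hu : u ∈ Ioo (0:ℝ) 1) : cdf' Z (quant Z u) = u := by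
  have := Measure.isProbabilityMeasure_map (μ := (ℙ : Measure Ω)) hZ.aemeasurable
  set f := cdf (Measure.map Z ℙ) with hf
  have hfe : cdf' Z = f := funext (aux_cdf Z hZ)
  have hne : {z : ℝ | u ≤ f z}.Nonempty := by
    obtain ⟨z, hz⟩ := ((tendsto_cdf_atTop (Measure.map Z ℙ)).eventually_const_lt hu.2).exists
    exact ⟨z, hz.le⟩
  have hbd : BddBelow {z : ℝ | u ≤ f z} := by
    obtain ⟨z, hz⟩ := ((tendsto_cdf_atBot (Measure.map Z ℙ)).eventually_lt_const hu.1).exists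
    refine ⟨z, fun w hw => ?_⟩
    by_contra! h
    exact absurd (hw.trans (f.mono h.le)) (not_le.2 hz)
  rw [quant, hfe]
  set q := sInf {z : ℝ | u ≤ f z} with hq
  apply le_antisymm
  · have h1 : f q ≤ Function.leftLim f q := by
      have := f.measure_singleton q
      rw [hf, measure_cdf, hna q, eq_comm, ENNReal.ofReal_eq_zero] at this
      rw [hf]; linarith
    refine h1.trans ?_
    refine le_of_tendsto (f.mono.tendsto_leftLim q) ?_
    filter_upwards [self_mem_nhdsWithin] with z hz
    by_contra! h
    exact absurd (csInf_le hbd h.le) (not_le.2 hz)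
  · have hr : Tendsto f (𝓝[>] q) (𝓝 (f q)) :=
      (f.right_continuous q).tendsto.mono_left (nhdsWithin_mono _ Ioi_subset_Ici_self)
    refine ge_of_tendsto hr ?_
    filter_upwards [self_mem_nhdsWithin] with z hz
    obtain ⟨w, hw, hwz⟩ := exists_lt_of_csInf_lt hne hz
    exact le_trans hw (f.mono hwz.le)

/-- Lemma 1: integral representation of the conditional tail probability in the
one-factor model `X = β·Y + ε`. -/
theorem conditional_tail_integral_representation
    {Ω : Type*} [MeasureSpace Ω] [IsProbabilityMeasure (ℙ : Measure Ω)]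
    (Y ε X : Ω → ℝ) (hYm : Measurable Y) (hεm : Measurable ε)
    (hindep : IndepFun Y ε ℙ)
    (β : ℝ) (hβ : 0 < β)
    (hXdef : ∀ ω, X ω = β * Y ω + ε ω)
    (P_Y : ℝ → ℝ) (hPm : Measurable P_Y) (hPnn : ∀ y, 0 ≤ P_Y y)
    (hdens : Measure.map Y ℙ
      = (volume : Measure ℝ).withDensity (fun y => ENNReal.ofReal (P_Y y)))
    (u : ℝ) (hu : u ∈ Ioo (0:ℝ) 1) (hq : 0 < quant Y u) :
    condP {ω | quant X u < X ω} {ω | quant Y u < Y ω}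
      = (quant Y u / (1 - u)) *
        ∫ x in Ici (1:ℝ),
          P_Y (quant Y u * x) * surv ε (quant X u - β * quant Y u * x) := by
  have hB : (ℙ {ω | quant Y u < Y ω}).toReal = 1 - u := by
    have h := aux_surv Y hYm (quant Y u)
    rw [surv, aux_quant Y hYm (by intro z; rw [hdens]; exact withDensity_absolutelyContinuous _ _ (by simp)) u hu,
      Measure.map_apply hYm measurableSet_Ioi] at h
    exact h.symm
  set q := quant Y u with hqd
  set t := quant X u with htd
  have := Measure.isProbabilityMeasure_map (μ := (ℙ : Measure Ω)) hYm.aemeasurable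
  have := Measure.isProbabilityMeasure_map (μ := (ℙ : Measure Ω)) hεm.aemeasurable
  have hsm : Measurable (fun z => (Measure.map ε ℙ) (Ioi z)) :=
    Antitone.measurable (fun a b h => measure_mono (Ioi_subset_Ioi h))
  have hsm' : Measurable (fun y : ℝ => (Measure.map ε ℙ) (Ioi (t - β * y))) :=
    hsm.comp (by fun_prop)
  have hA : ℙ ({ω | t < X ω} ∩ {ω | q < Y ω})
      = ∫⁻ y in Ioi q, ENNReal.ofReal (P_Y y) * (Measure.map ε ℙ) (Ioi (t - β * y)) := by
    have hS : MeasurableSet {p : ℝ × ℝ | t < β * p.1 + p.2 ∧ q < p.1} := by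
      have a1 : MeasurableSet {p : ℝ × ℝ | t < β * p.1 + p.2} :=
        measurableSet_lt (by fun_prop) (by fun_prop)
      have a2 : MeasurableSet {p : ℝ × ℝ | q < p.1} :=
        measurableSet_lt (by fun_prop) (by fun_prop)
      exact a1.inter a2
    have h1 : ({ω | t < X ω} ∩ {ω | q < Y ω})
        = (fun ω => (Y ω, ε ω)) ⁻¹' {p : ℝ × ℝ | t < β * p.1 + p.2 ∧ q < p.1} := by
      ext ω; simp [hXdef]
    rw [h1, ← Measure.map_apply (hYm.prodMk hεm) hS,
      (indepFun_iff_map_prod_eq_prod_map_map hYm.aemeasurable hεm.aemeasurable).1 hindep,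
      Measure.prod_apply hS]
    have h2 : ∀ y, (Measure.map ε ℙ) (Prod.mk y ⁻¹' {p : ℝ × ℝ | t < β * p.1 + p.2 ∧ q < p.1})
        = (Ioi q).indicator (fun y => (Measure.map ε ℙ) (Ioi (t - β * y))) y := by
      intro y
      by_cases hy : q < y
      · rw [indicator_of_mem (by exact hy)]
        congr 1
        ext e
        simp [hy, sub_lt_iff_lt_add']
      · rw [indicator_of_notMem (by exact hy)]
        simp [hy]
    simp_rw [h2]
    rw [lintegral_indicator measurableSet_Ioi, hdens,
      setLIntegral_withDensity_eq_setLIntegral_mul _ hPm.ennreal_ofReal hsm' measurableSet_Ioi]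
    rfl
  have hI : ∫ y in Ioi q, P_Y y * surv ε (t - β * y)
      = (ℙ ({ω | t < X ω} ∩ {ω | q < Y ω})).toReal := by
    rw [hA]
    simp_rw [aux_surv ε hεm]
    rw [integral_eq_lintegral_of_nonneg_ae
      (Eventually.of_forall fun y => mul_nonneg (hPnn y) ENNReal.toReal_nonneg)
      (hPm.mul hsm'.ennreal_toReal).aestronglyMeasurable]
    congr 1
    refine lintegral_congr fun y => ?_
    rw [ENNReal.ofReal_mul (hPnn y), ENNReal.ofReal_toReal (measure_ne_top _ _)]
  have hc := integral_comp_mul_left_Ioi (fun y => P_Y y * surv ε (t - β * y)) 1 hq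
  rw [mul_one, hI] at hc
  rw [condP, hB, integral_Ici_eq_integral_Ioi]
  simp_rw [mul_assoc β q]
  rw [hc, smul_eq_mul]
  have : 1 - u ≠ 0 := by linarith [hu.2]
  field_simp
end

section
/- Let Y and ε be independent real random variables on a probability space (Ω, 𝒜, ℙ), let β > 0 and set X = β·Y + ε. Assume Y has a probability density P_Y; F_Y(y) < 1 and F_X(x) < 1 for all real y, x; (H1) for every x ≥ 1, lim_{t→∞} t·P_Y(t·x)/F̄_Y(t) = f(x); and (H3) lim_{u→1⁻} F_X⁻¹(u)/F_Y⁻¹(u) = l with l > 0. For u ∈ (0, 1) with F_Y⁻¹(u) > 0 define f_u(x) = (F_Y⁻¹(u)/(1 − u)) · P_Y(F_Y⁻¹(u)·x) · F̄_ε(F_X⁻¹(u) − β·F_Y⁻¹(u)·x). Then for every x ≥ 1 with β·x ≠ l, f_u(x) converges to 𝟙{β·x > l}·f(x) as u → 1⁻. -/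
open MeasureTheory ProbabilityTheory Filter Set Topology

theorem cdf'_eq_cdf {Ω : Type*} [MeasureSpace Ω] [IsProbabilityMeasure (ℙ : Measure Ω)]
    (Z : Ω → ℝ) (hZ : Measurable Z) (z : ℝ) :
    cdf' Z z = ProbabilityTheory.cdf (Measure.map Z ℙ) z := by
  have : IsProbabilityMeasure (Measure.map Z ℙ) := Measure.isProbabilityMeasure_map hZ.aemeasurable
  rw [ProbabilityTheory.cdf_eq_real, measureReal_def, Measure.map_apply hZ measurableSet_Iic]
  rfl

theorem cdf_continuous_of_nullSing (μ : Measure ℝ) [IsProbabilityMeasure μ] [NullSingletonClass μ] :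
    Continuous (ProbabilityTheory.cdf μ) := by
  rw [continuous_iff_continuousAt]
  intro a
  have hm : Monotone (ProbabilityTheory.cdf μ) := (ProbabilityTheory.cdf μ).mono
  rw [hm.continuousAt_iff_leftLim_eq_rightLim, StieltjesFunction.rightLim_eq]
  have h := StieltjesFunction.measure_singleton (ProbabilityTheory.cdf μ) a
  rw [ProbabilityTheory.measure_cdf, measure_singleton] at h
  have h1 := ENNReal.ofReal_eq_zero.1 h.symm
  have h2 := hm.leftLim_le (le_refl a)
  linarith

theorem cdf_quant {Ω : Type*} [MeasureSpace Ω] [IsProbabilityMeasure (ℙ : Measure Ω)]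
    (Y : Ω → ℝ) (hY : Measurable Y) (hc : Continuous (cdf' Y)) (u : ℝ) (h0 : 0 < u) (h1 : u < 1) :
    cdf' Y (quant Y u) = u := by
  have hE : cdf' Y = ProbabilityTheory.cdf (Measure.map Y ℙ) := funext (cdf'_eq_cdf Y hY)
  have hm : Monotone (cdf' Y) := by rw [hE]; exact (ProbabilityTheory.cdf _).mono
  have hbot : Tendsto (cdf' Y) atBot (𝓝 0) := by
    rw [hE]; exact ProbabilityTheory.tendsto_cdf_atBot _
  have htop : Tendsto (cdf' Y) atTop (𝓝 1) := by
    rw [hE]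
    exact ProbabilityTheory.tendsto_cdf_atTop _
  obtain ⟨a, ha⟩ := (hbot.eventually (gt_mem_nhds h0)).exists
  obtain ⟨b, hb⟩ := (htop.eventually (lt_mem_nhds h1)).exists
  obtain ⟨y, hy⟩ := mem_range_of_exists_le_of_exists_ge hc ⟨a, ha.le⟩ ⟨b, hb.le⟩
  have hbdd : BddBelow {z : ℝ | u ≤ cdf' Y z} := by
    refine ⟨a, fun z hz => ?_⟩
    by_contra hlt
    have := hm (not_le.1 hlt).le
    have hz' : u ≤ cdf' Y z := hz
    linarith
  have hcl : IsClosed {z : ℝ | u ≤ cdf' Y z} := isClosed_le continuous_const hc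
  have hmem : u ≤ cdf' Y (quant Y u) := hcl.csInf_mem ⟨y, hy.ge⟩ hbdd
  have hle : quant Y u ≤ y := csInf_le hbdd hy.ge
  exact le_antisymm ((hm hle).trans hy.le) hmem

/-- Lemma 2: pointwise convergence of `f_u(x)` to `𝟙{β·x > l}·f(x)` as `u → 1⁻`. -/
theorem fu_pointwise_limit
    {Ω : Type*} [MeasureSpace Ω] [IsProbabilityMeasure (ℙ : Measure Ω)]
    (Y ε X : Ω → ℝ) (hYm : Measurable Y) (hεm : Measurable ε)
    (hindep : IndepFun Y ε ℙ)
    (β : ℝ) (hβ : 0 < β)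
    (hXdef : ∀ ω, X ω = β * Y ω + ε ω)
    (hFY : ∀ y : ℝ, cdf' Y y < 1) (hFX : ∀ x : ℝ, cdf' X x < 1)
    (P_Y : ℝ → ℝ) (hPm : Measurable P_Y) (hPnn : ∀ y, 0 ≤ P_Y y)
    (hdens : Measure.map Y ℙ
      = (volume : Measure ℝ).withDensity (fun y => ENNReal.ofReal (P_Y y)))
    (f : ℝ → ℝ)
    (hH1 : ∀ x ≥ (1:ℝ), Tendsto (fun t => t * P_Y (t * x) / surv Y t) atTop (𝓝 (f x)))
    (l : ℝ) (hl : 0 < l)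
    (hH3 : Tendsto (fun u => quant X u / quant Y u) (𝓝[<] (1:ℝ)) (𝓝 l))
    (x : ℝ) (hx : 1 ≤ x) (hxl : β * x ≠ l) :
    Tendsto
      (fun u => (quant Y u / (1 - u)) * P_Y (quant Y u * x)
        * surv ε (quant X u - β * quant Y u * x))
      (𝓝[<] (1:ℝ))
      (𝓝 (if l < β * x then f x else 0)) := by
  have hprobY : IsProbabilityMeasure (Measure.map Y ℙ) :=
    Measure.isProbabilityMeasure_map hYm.aemeasurable
  have hna : NullSingletonClass (Measure.map Y ℙ) := by rw [hdens]; infer_instance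
  have hEY : cdf' Y = ProbabilityTheory.cdf (Measure.map Y ℙ) := funext (cdf'_eq_cdf Y hYm)
  have hEε : cdf' ε = ProbabilityTheory.cdf (Measure.map ε ℙ) := funext (cdf'_eq_cdf ε hεm)
  have hcY : Continuous (cdf' Y) := by rw [hEY]; exact cdf_continuous_of_nullSing _
  have hmY : Monotone (cdf' Y) := by rw [hEY]; exact (ProbabilityTheory.cdf _).mono
  have hεbot : Tendsto (surv ε) atBot (𝓝 1) := by
    have : Tendsto (cdf' ε) atBot (𝓝 0) := by
      rw [hEε]; exact ProbabilityTheory.tendsto_cdf_atBot _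
    simpa [funext_iff, surv] using (show Tendsto (surv ε) _ (𝓝 (1 - _)) from this.const_sub 1)
  have hεtop : Tendsto (surv ε) atTop (𝓝 0) := by
    have : Tendsto (cdf' ε) atTop (𝓝 1) := by
      rw [hEε]
      exact ProbabilityTheory.tendsto_cdf_atTop _
    simpa [funext_iff, surv] using (show Tendsto (surv ε) _ (𝓝 (1 - _)) from this.const_sub 1)
  have hev : ∀ a < (1:ℝ), ∀ᶠ u in 𝓝[<] (1:ℝ), a < u ∧ u < 1 := fun a ha =>
    Ioo_mem_nhdsLT ha
  have hq : Tendsto (quant Y) (𝓝[<] (1:ℝ)) atTop := by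
    rw [tendsto_atTop]
    intro M
    filter_upwards [hev 0 one_pos, hev _ (hFY M)] with u hu hu2
    have h := cdf_quant Y hYm hcY u hu.1 hu.2
    by_contra hlt
    have := hmY (not_le.1 hlt).le
    linarith
  have hA : Tendsto (fun u => quant Y u * P_Y (quant Y u * x) / surv Y (quant Y u))
      (𝓝[<] (1:ℝ)) (𝓝 (f x)) := (hH1 x hx).comp hq
  have hr : Tendsto (fun u => quant X u / quant Y u - β * x) (𝓝[<] (1:ℝ)) (𝓝 (l - β * x)) :=
    hH3.sub_const _
  have hB : Tendsto (fun u => surv ε (quant Y u * (quant X u / quant Y u - β * x)))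
      (𝓝[<] (1:ℝ)) (𝓝 (if l < β * x then 1 else 0)) := by
    split_ifs with h
    · exact hεbot.comp (hq.atTop_mul_neg (by linarith) hr)
    · have h' : β * x < l := lt_of_le_of_ne (not_lt.1 h) hxl
      exact hεtop.comp (hq.atTop_mul_pos (by linarith) hr)
  have hAB := hA.mul hB
  have hlim : f x * (if l < β * x then (1:ℝ) else 0) = if l < β * x then f x else 0 := by
    split_ifs <;> simp
  rw [hlim] at hAB
  refine hAB.congr' ?_
  filter_upwards [hev 0 one_pos, hq.eventually_gt_atTop 0] with u hu hpos
  have h := cdf_quant Y hYm hcY u hu.1 hu.2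
  have e1 : surv Y (quant Y u) = 1 - u := by rw [surv, h]
  have e2 : quant Y u * (quant X u / quant Y u - β * x) = quant X u - β * quant Y u * x := by
    field_simp
  rw [e1, e2]
  ring
end

section
/- Let Y and ε be independent real random variables on a probability space (Ω, 𝒜, ℙ), let β > 0 and set X = β·Y + ε. Assume F_Y(y) < 1 and F_X(x) < 1 for all real y, x; Y has a probability density P_Y; sup_{y > 0} y·P_Y(y)/F̄_Y(y) < ∞; (H1) holds with f(x) = α·x^{−(α+1)} for some α > 0, i.e. for every x ≥ 1, lim_{t→∞} t·P_Y(t·x)/F̄_Y(t) = α·x^{−(α+1)}; (H2) there exist t₀ > 0, δ > 0, A > 0 with F̄_Y(t·x)/F̄_Y(t) ≤ A·x^{−δ} for all t ≥ t₀, x ≥ 1; and (H3) lim_{u→1⁻} F_X⁻¹(u)/F_Y⁻¹(u) = l with l > 0. Then the coefficient of upper tail dependence exists and equals λ₊ = 1/(max{1, l/β})^α = min{1, (β/l)^α}. -/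
open MeasureTheory ProbabilityTheory Filter Set Topology

section Helpers

variable {Ω : Type*} [MeasureSpace Ω] [IsProbabilityMeasure (ℙ : Measure Ω)]

lemma surv_eq (Y : Ω → ℝ) (hY : Measurable Y) (t : ℝ) :
    surv Y t = (ℙ : Measure Ω).real {ω | t < Y ω} := by
  have h : {ω | t < Y ω} = {ω | Y ω ≤ t}ᶜ := by ext; simp
  rw [h, probReal_compl_eq_one_sub (measurableSet_le hY measurable_const)]
  rfl

lemma surv_sub (Y : Ω → ℝ) (hY : Measurable Y) (P : ℝ → ℝ) (hPm : Measurable P)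
    (hP : ∀ y, 0 ≤ P y)
    (hd : Measure.map Y ℙ = (volume : Measure ℝ).withDensity (fun y => ENNReal.ofReal (P y)))
    (a b : ℝ) (hab : a ≤ b) : surv Y a - surv Y b = ∫ z in a..b, P z := by
  have h1 : (ℙ : Measure Ω) (Y ⁻¹' (Ioc a b)) = ∫⁻ z in Ioc a b, ENNReal.ofReal (P z) := by
    rw [← Measure.map_apply hY measurableSet_Ioc, hd, withDensity_apply _ measurableSet_Ioc]
  rw [intervalIntegral.integral_of_le hab,
    integral_eq_lintegral_of_nonneg_ae (ae_of_all _ hP) hPm.aestronglyMeasurable, ← h1,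
    surv_eq Y hY, surv_eq Y hY]
  have h2 : {ω | a < Y ω} = Y ⁻¹' (Ioc a b) ∪ {ω | b < Y ω} := by
    ext ω
    simp only [mem_ofPred_eq, mem_union, mem_preimage, mem_Ioc]
    constructor
    · intro h
      rcases le_or_gt (Y ω) b with h' | h'
      · exact Or.inl ⟨h, h'⟩
      · exact Or.inr h'
    · rintro (h | h)
      · exact h.1
      · linarith
  have h3 : Disjoint (Y ⁻¹' (Ioc a b)) {ω | b < Y ω} := by
    rw [Set.disjoint_left]
    intro ω h h'
    simp only [mem_ofPred_eq, mem_preimage, mem_Ioc] at h h'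
    linarith [h.2]
  rw [h2, measureReal_union h3 (measurableSet_lt measurable_const hY)]
  simp [Measure.real]

lemma surv_anti (Y : Ω → ℝ) (hY : Measurable Y) {a b : ℝ} (hab : a ≤ b) :
    surv Y b ≤ surv Y a := by
  rw [surv_eq Y hY, surv_eq Y hY]
  exact measureReal_mono (fun ω h => lt_of_le_of_lt hab h)

lemma ratio_sub (Y : Ω → ℝ) (hY : Measurable Y) (P : ℝ → ℝ) (hPm : Measurable P)
    (hP : ∀ y, 0 ≤ P y)
    (hd : Measure.map Y ℙ = (volume : Measure ℝ).withDensity (fun y => ENNReal.ofReal (P y)))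
    (t a b : ℝ) (ht : 0 < t) (hab : a ≤ b) :
    surv Y (t * a) / surv Y t - surv Y (t * b) / surv Y t
      = ∫ z in a..b, t * P (t * z) / surv Y t := by
  rw [← sub_div, surv_sub Y hY P hPm hP hd _ _ (by gcongr), intervalIntegral.integral_div,
    intervalIntegral.integral_const_mul, intervalIntegral.integral_comp_mul_left P ht.ne']
  simp only [smul_eq_mul]
  field_simp

lemma integrand_bound (Y : Ω → ℝ) (hY : Measurable Y) (P : ℝ → ℝ)
    (hP : ∀ y, 0 ≤ P y) (hFY : ∀ y : ℝ, 0 < surv Y y)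
    (M : ℝ) (hM : ∀ y > (0:ℝ), y * P y / surv Y y ≤ M) (t z : ℝ) (ht : 0 < t) (hz : 1 ≤ z) :
    ‖t * P (t * z) / surv Y t‖ ≤ M := by
  have hs := hFY t
  have h0 : 0 ≤ P (t * z) := hP _
  rw [Real.norm_of_nonneg (by positivity)]
  have h1 := hM (t * z) (by positivity)
  rw [div_le_iff₀ (hFY _)] at h1
  have hM0 : 0 ≤ M := by
    refine le_trans ?_ (hM 1 one_pos)
    have := hFY 1
    have := hP 1
    positivity
  rw [div_le_iff₀ hs]
  have h2 : surv Y (t * z) ≤ surv Y t := surv_anti Y hY (by nlinarith)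
  have h3 : t * P (t * z) ≤ t * z * P (t * z) := by
    apply mul_le_mul_of_nonneg_right _ h0
    nlinarith
  nlinarith [mul_le_mul_of_nonneg_left h2 hM0]

lemma ratio_lip (Y : Ω → ℝ) (hY : Measurable Y) (P : ℝ → ℝ) (hPm : Measurable P)
    (hP : ∀ y, 0 ≤ P y)
    (hd : Measure.map Y ℙ = (volume : Measure ℝ).withDensity (fun y => ENNReal.ofReal (P y)))
    (hFY : ∀ y : ℝ, 0 < surv Y y)
    (M : ℝ) (hM : ∀ y > (0:ℝ), y * P y / surv Y y ≤ M)
    (t a b : ℝ) (ht : 0 < t) (ha : 1 ≤ a) (hb : 1 ≤ b) :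
    |surv Y (t * a) / surv Y t - surv Y (t * b) / surv Y t| ≤ M * |a - b| := by
  wlog hab : a ≤ b generalizing a b
  · rw [abs_sub_comm, abs_sub_comm a b]
    exact this b a hb ha (le_of_not_ge hab)
  rw [ratio_sub Y hY P hPm hP hd t a b ht hab, abs_sub_comm a b]
  rw [← Real.norm_eq_abs]
  apply intervalIntegral.norm_integral_le_of_norm_le_const
  intro z hz
  rw [uIoc_of_le hab] at hz
  exact integrand_bound Y hY P hP hFY M hM t z ht (by linarith [hz.1])

lemma ratio_tendsto (Y : Ω → ℝ) (hY : Measurable Y) (P : ℝ → ℝ) (hPm : Measurable P)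
    (hP : ∀ y, 0 ≤ P y)
    (hd : Measure.map Y ℙ = (volume : Measure ℝ).withDensity (fun y => ENNReal.ofReal (P y)))
    (hFY : ∀ y : ℝ, 0 < surv Y y)
    (M : ℝ) (hM : ∀ y > (0:ℝ), y * P y / surv Y y ≤ M) (α : ℝ) (hα : 0 < α)
    (hH1 : ∀ x ≥ (1:ℝ), Tendsto (fun t => t * P (t * x) / surv Y t) atTop
      (𝓝 (α * x ^ (-(α + 1))))) (x : ℝ) (hx : 1 ≤ x) :
    Tendsto (fun t => surv Y (t * x) / surv Y t) atTop (𝓝 (x ^ (-α))) := by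
  have h1 : Tendsto (fun t => ∫ z in (1:ℝ)..x, t * P (t * z) / surv Y t) atTop
      (𝓝 (∫ z in (1:ℝ)..x, α * z ^ (-(α + 1)))) := by
    apply intervalIntegral.tendsto_integral_filter_of_dominated_convergence (fun _ => M)
    · refine Eventually.of_forall fun t => ?_
      have : Measurable (fun z => t * P (t * z) / surv Y t) := by fun_prop
      exact this.aestronglyMeasurable
    · filter_upwards [eventually_gt_atTop 0] with t ht
      refine ae_of_all _ fun z hz => ?_
      rw [uIoc_of_le hx] at hz
      exact integrand_bound Y hY P hP hFY M hM t z ht hz.1.le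
    · exact intervalIntegrable_const
    · refine ae_of_all _ fun z hz => ?_
      rw [uIoc_of_le hx] at hz
      exact hH1 z hz.1.le
  have h2 : ∫ z in (1:ℝ)..x, α * z ^ (-(α + 1)) = 1 - x ^ (-α) := by
    rw [intervalIntegral.integral_const_mul, integral_rpow]
    · have : -(α + 1) + 1 = -α := by ring
      rw [this, Real.one_rpow]
      field_simp
      ring
    · right
      refine ⟨by intro h; linarith, ?_⟩
      rw [uIcc_of_le hx]
      intro h
      linarith [h.1]
  rw [h2] at h1
  have h3 := (tendsto_const_nhds (x := (1:ℝ))).sub h1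
  rw [sub_sub_cancel] at h3
  refine h3.congr' ?_
  filter_upwards [eventually_gt_atTop 0] with t ht
  rw [← ratio_sub Y hY P hPm hP hd t 1 x ht hx, mul_one, div_self (hFY t).ne']
  ring

lemma quant_atTop (Y : Ω → ℝ) (hY : Measurable Y) (hFY : ∀ y : ℝ, cdf' Y y < 1) :
    Tendsto (quant Y) (𝓝[<] (1:ℝ)) atTop := by
  have hcdf : ∀ z, cdf' Y z = cdf (Measure.map Y ℙ) z := by
    intro z
    have := Measure.isProbabilityMeasure_map (μ := (ℙ : Measure Ω)) hY.aemeasurable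
    rw [cdf_eq_real, Measure.real, Measure.map_apply hY measurableSet_Iic]
    rfl
  rw [tendsto_atTop]
  intro R
  have h1 : ∀ᶠ u in 𝓝[<] (1:ℝ), cdf' Y R < u :=
    mem_nhdsWithin_of_mem_nhds (lt_mem_nhds (hFY R))
  filter_upwards [h1, self_mem_nhdsWithin] with u hu hu1
  apply le_csInf
  · have h := (tendsto_cdf_atTop (Measure.map Y ℙ)).eventually (lt_mem_nhds hu1)
    obtain ⟨z, hz⟩ := h.exists
    exact ⟨z, by rw [mem_ofPred_eq, hcdf]; exact hz.le⟩
  · intro z hz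
    by_contra hlt
    push Not at hlt
    have : cdf' Y z ≤ cdf' Y R := by rw [hcdf, hcdf]; exact monotone_cdf _ hlt.le
    have hz' : u ≤ cdf' Y z := hz
    linarith

lemma eps_upper (ε : Ω → ℝ) (hε : Measurable ε) :
    Tendsto (fun N : ℝ => (ℙ : Measure Ω).real {ω | N < ε ω}) atTop (𝓝 0) := by
  have hp := Measure.isProbabilityMeasure_map (μ := (ℙ : Measure Ω)) hε.aemeasurable
  have h := (tendsto_const_nhds (x := (1:ℝ))).sub (tendsto_cdf_atTop (Measure.map ε ℙ))
  rw [sub_self] at h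
  refine h.congr fun N => ?_
  rw [← surv_eq ε hε, surv, cdf_eq_real, Measure.real, Measure.map_apply hε measurableSet_Iic]
  rfl

lemma eps_lower (ε : Ω → ℝ) (hε : Measurable ε) :
    Tendsto (fun N : ℝ => (ℙ : Measure Ω).real {ω | -N < ε ω}) atTop (𝓝 1) := by
  have hp := Measure.isProbabilityMeasure_map (μ := (ℙ : Measure Ω)) hε.aemeasurable
  have h := (tendsto_const_nhds (x := (1:ℝ))).sub
    ((tendsto_cdf_atBot (Measure.map ε ℙ)).comp tendsto_neg_atTop_atBot)
  rw [sub_zero] at h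
  refine h.congr fun N => ?_
  rw [← surv_eq ε hε, surv, Function.comp, cdf_eq_real, Measure.real,
    Measure.map_apply hε measurableSet_Iic]
  rfl

lemma indep_real (Y ε : Ω → ℝ) (hi : IndepFun Y ε ℙ) (a b : ℝ) :
    (ℙ : Measure Ω).real ({ω | a < Y ω} ∩ {ω | b < ε ω})
      = (ℙ : Measure Ω).real {ω | a < Y ω} * (ℙ : Measure Ω).real {ω | b < ε ω} := by
  have := hi.measure_inter_preimage_eq_mul (Ioi a) (Ioi b) measurableSet_Ioi measurableSet_Ioi
  have h := congrArg ENNReal.toReal this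
  rw [ENNReal.toReal_mul] at h
  exact h

end Helpers

/-- Corollary 2: for a regularly varying factor with tail index `α`, the
coefficient of upper tail dependence equals `1/(max{1, l/β})^α = min{1, (β/l)^α}`. -/
theorem tail_dependence_regularly_varying_factor
    {Ω : Type*} [MeasureSpace Ω] [IsProbabilityMeasure (ℙ : Measure Ω)]
    (Y ε X : Ω → ℝ) (hYm : Measurable Y) (hεm : Measurable ε)
    (hindep : IndepFun Y ε ℙ)
    (β : ℝ) (hβ : 0 < β)
    (hXdef : ∀ ω, X ω = β * Y ω + ε ω)
    (hFY : ∀ y : ℝ, cdf' Y y < 1) (hFX : ∀ x : ℝ, cdf' X x < 1)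
    (P_Y : ℝ → ℝ) (hPm : Measurable P_Y) (hPnn : ∀ y, 0 ≤ P_Y y)
    (hdens : Measure.map Y ℙ
      = (volume : Measure ℝ).withDensity (fun y => ENNReal.ofReal (P_Y y)))
    (hbdd : ∃ M : ℝ, ∀ y > (0:ℝ), y * P_Y y / surv Y y ≤ M)
    (α : ℝ) (hα : 0 < α)
    (hH1 : ∀ x ≥ (1:ℝ), Tendsto (fun t => t * P_Y (t * x) / surv Y t) atTop
      (𝓝 (α * x ^ (-(α + 1)))))
    (hH2 : ∃ t₀ > (0:ℝ), ∃ δ > (0:ℝ), ∃ A > (0:ℝ),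
      ∀ t ≥ t₀, ∀ x ≥ (1:ℝ), surv Y (t * x) / surv Y t ≤ A * x ^ (-δ))
    (l : ℝ) (hl : 0 < l)
    (hH3 : Tendsto (fun u => quant X u / quant Y u) (𝓝[<] (1:ℝ)) (𝓝 l)) :
    Tendsto (fun u => condP {ω | quant X u < X ω} {ω | quant Y u < Y ω})
      (𝓝[<] (1:ℝ)) (𝓝 (1 / (max 1 (l / β)) ^ α))
    ∧ 1 / (max 1 (l / β)) ^ α = min 1 ((β / l) ^ α) := by
  obtain ⟨M, hM⟩ := hbdd
  have hS : ∀ y : ℝ, 0 < surv Y y := fun y => sub_pos.2 (hFY y)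
  have hqY := quant_atTop Y hYm hFY
  set m := max 1 (l / β) with hm
  have hm1 : 1 ≤ m := le_max_left _ _
  have hlim : 1 / m ^ α = m ^ (-α) := by
    rw [Real.rpow_neg (by linarith), one_div]
  refine ⟨?_, ?_⟩
  swap
  · rcases le_total (l / β) 1 with h | h
    · have h' : 1 ≤ β / l := by
        rw [div_le_one hβ] at h
        rwa [one_le_div hl]
      rw [hm, max_eq_left h, Real.one_rpow, min_eq_left (Real.one_le_rpow h' hα.le)]
      norm_num
    · have h' : β / l ≤ 1 := by
        rw [one_le_div hβ] at h
        rwa [div_le_one hl]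
      rw [hm, max_eq_right h, min_eq_right (Real.rpow_le_one (by positivity) h' hα.le),
        one_div, ← Real.inv_rpow (by positivity), inv_div]
  rw [hlim]
  -- the key limit, for a shift `c`
  have key : ∀ c : ℝ, Tendsto
      (fun u => surv Y (max (quant Y u) ((quant X u + c) / β)) / surv Y (quant Y u))
      (𝓝[<] (1:ℝ)) (𝓝 (m ^ (-α))) := by
    intro c
    have hmu : Tendsto (fun u => max 1 ((quant X u / quant Y u + c / quant Y u) / β))
        (𝓝[<] (1:ℝ)) (𝓝 m) := by
      have h0 : Tendsto (fun u => c / quant Y u) (𝓝[<] (1:ℝ)) (𝓝 0) := hqY.const_div_atTop c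
      have h1 := (hH3.add h0).div_const β
      rw [add_zero] at h1
      exact tendsto_const_nhds.max h1
    have hr := (ratio_tendsto Y hYm P_Y hPm hPnn hdens hS M hM α hα hH1 m hm1).comp hqY
    have hd0 : Tendsto (fun u => M * |max 1 ((quant X u / quant Y u + c / quant Y u) / β) - m|)
        (𝓝[<] (1:ℝ)) (𝓝 0) := by
      have := ((hmu.sub_const m).abs).const_mul M
      simpa using this
    have hdiff : Tendsto (fun u =>
        surv Y (quant Y u * max 1 ((quant X u / quant Y u + c / quant Y u) / β))
          / surv Y (quant Y u) - surv Y (quant Y u * m) / surv Y (quant Y u))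
        (𝓝[<] (1:ℝ)) (𝓝 0) := by
      apply squeeze_zero_norm' _ hd0
      filter_upwards [hqY.eventually_gt_atTop 0] with u hu
      exact ratio_lip Y hYm P_Y hPm hPnn hdens hS M hM _ _ _ hu (le_max_left _ _) hm1
    have hsum := hdiff.add hr
    rw [zero_add] at hsum
    refine hsum.congr' ?_
    filter_upwards [hqY.eventually_gt_atTop 0] with u hu
    have he : quant Y u * max 1 ((quant X u / quant Y u + c / quant Y u) / β)
        = max (quant Y u) ((quant X u + c) / β) := by
      rw [mul_max_of_nonneg _ _ hu.le, mul_one]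
      congr 1
      field_simp
    simp only [Function.comp, he]
    ring
  have hcond : ∀ u, condP {ω | quant X u < X ω} {ω | quant Y u < Y ω}
      = (ℙ : Measure Ω).real ({ω | quant X u < X ω} ∩ {ω | quant Y u < Y ω})
        / surv Y (quant Y u) := by
    intro u
    rw [surv_eq Y hYm]
    rfl
  have hup : ∀ (N u : ℝ), condP {ω | quant X u < X ω} {ω | quant Y u < Y ω}
      ≤ (ℙ : Measure Ω).real {ω | N < ε ω}
        + surv Y (max (quant Y u) ((quant X u + -N) / β)) / surv Y (quant Y u) := by
    intro N u
    rw [hcond, div_le_iff₀ (hS _), add_mul, div_mul_cancel₀ _ (hS _).ne']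
    have hsub : {ω | quant X u < X ω} ∩ {ω | quant Y u < Y ω} ⊆
        ({ω | quant Y u < Y ω} ∩ {ω | N < ε ω}) ∪
          {ω | max (quant Y u) ((quant X u + -N) / β) < Y ω} := by
      rintro ω ⟨h1, h2⟩
      simp only [mem_ofPred_eq] at h1 h2
      rcases lt_or_ge N (ε ω) with h | h
      · exact Or.inl ⟨h2, h⟩
      · right
        simp only [mem_ofPred_eq, max_lt_iff]
        refine ⟨h2, ?_⟩
        rw [div_lt_iff₀ hβ]
        rw [hXdef] at h1
        linarith
    refine (measureReal_mono hsub).trans ((measureReal_union_le _ _).trans ?_)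
    rw [indep_real Y ε hindep, surv_eq Y hYm, surv_eq Y hYm, mul_comm]
  have hlo : ∀ (N u : ℝ), (ℙ : Measure Ω).real {ω | -N < ε ω}
        * (surv Y (max (quant Y u) ((quant X u + N) / β)) / surv Y (quant Y u))
      ≤ condP {ω | quant X u < X ω} {ω | quant Y u < Y ω} := by
    intro N u
    rw [hcond, ← mul_div_assoc]
    refine div_le_div_of_nonneg_right ?_ (hS _).le
    rw [surv_eq Y hYm, mul_comm, ← indep_real Y ε hindep]
    refine measureReal_mono ?_
    rintro ω ⟨h1, h2⟩
    simp only [mem_ofPred_eq, max_lt_iff] at h1 h2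
    refine ⟨?_, h1.1⟩
    have h3 := h1.2
    rw [div_lt_iff₀ hβ] at h3
    simp only [mem_ofPred_eq]
    rw [hXdef]
    linarith
  rw [tendsto_order]
  constructor
  · intro a ha
    have h1 := (eps_lower ε hεm).mul_const (m ^ (-α))
    rw [one_mul] at h1
    obtain ⟨N, hN⟩ := (h1.eventually (lt_mem_nhds ha)).exists
    have h2 := (key N).const_mul ((ℙ : Measure Ω).real {ω | -N < ε ω})
    filter_upwards [h2.eventually (lt_mem_nhds hN)] with u hu
    exact lt_of_lt_of_le hu (hlo N u)
  · intro a ha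
    have h1 := (eps_upper ε hεm).add_const (m ^ (-α))
    rw [zero_add] at h1
    obtain ⟨N, hN⟩ := (h1.eventually (gt_mem_nhds ha)).exists
    have h2 := (key (-N)).const_add ((ℙ : Measure Ω).real {ω | N < ε ω})
    filter_upwards [h2.eventually (gt_mem_nhds hN)] with u hu
    exact lt_of_le_of_lt (hup N u) hu
end

section
/- Let Y and ε be independent real random variables on a probability space (Ω, 𝒜, ℙ), let β > 0 and set X = β·Y + ε. Assume there exist α > 0 and constants C₁ > 0, C₂ > 0 such that y^α·F̄_Y(y) → C₁ as y → ∞ and e^α·F̄_ε(e) → C₂ as e → ∞. Then the survival function of X satisfies x^α·F̄_X(x) → β^α·C₁ + C₂ as x → ∞; that is, F̄_X(x) ∼ x^{−α}·(β^α·C₁ + C₂). -/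
open MeasureTheory ProbabilityTheory Filter Set Topology

lemma surv_eq_s6 {Ω : Type*} [MeasureSpace Ω] [IsProbabilityMeasure (ℙ : Measure Ω)]
    {Z : Ω → ℝ} (hZ : Measurable Z) (z : ℝ) : surv Z z = (ℙ : Measure Ω).real {ω | z < Z ω} := by
  have h : {ω | z < Z ω} = {ω | Z ω ≤ z}ᶜ := by ext ω; simp
  rw [h, probReal_compl_eq_one_sub (measurableSet_le hZ measurable_const)]
  rfl

lemma surv_cdf {Ω : Type*} [MeasureSpace Ω] [IsProbabilityMeasure (ℙ : Measure Ω)]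
    {Z : Ω → ℝ} (hZ : Measurable Z) (z : ℝ) :
    surv Z z = 1 - ProbabilityTheory.cdf ((ℙ : Measure Ω).map Z) z := by
  haveI : IsProbabilityMeasure ((ℙ : Measure Ω).map Z) :=
    Measure.isProbabilityMeasure_map hZ.aemeasurable
  rw [ProbabilityTheory.cdf_eq_real, Measure.real, Measure.map_apply hZ measurableSet_Iic]
  rfl

lemma surv_top {Ω : Type*} [MeasureSpace Ω] [IsProbabilityMeasure (ℙ : Measure Ω)]
    {Z : Ω → ℝ} (hZ : Measurable Z) : Tendsto (surv Z) atTop (𝓝 0) := by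
  have h := (ProbabilityTheory.tendsto_cdf_atTop ((ℙ : Measure Ω).map Z)).const_sub 1
  rw [sub_self] at h
  exact h.congr fun z => (surv_cdf hZ z).symm

lemma surv_bot {Ω : Type*} [MeasureSpace Ω] [IsProbabilityMeasure (ℙ : Measure Ω)]
    {Z : Ω → ℝ} (hZ : Measurable Z) : Tendsto (surv Z) atBot (𝓝 1) := by
  have h := (ProbabilityTheory.tendsto_cdf_atBot ((ℙ : Measure Ω).map Z)).const_sub 1
  rw [sub_zero] at h
  exact h.congr fun z => (surv_cdf hZ z).symm

lemma tail_scale {S : ℝ → ℝ} {α C c : ℝ} (hc : 0 < c)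
    (h : Tendsto (fun y : ℝ => y ^ α * S y) atTop (𝓝 C)) :
    Tendsto (fun x : ℝ => x ^ α * S (c * x)) atTop (𝓝 (c ^ (-α) * C)) := by
  have h1 := (h.comp (tendsto_id.const_mul_atTop hc)).const_mul (c ^ (-α))
  refine h1.congr' ?_
  filter_upwards [eventually_gt_atTop 0] with x hx
  simp only [Function.comp, id]
  rw [Real.mul_rpow hc.le hx.le, Real.rpow_neg hc.le]
  have : c ^ α ≠ 0 := (Real.rpow_pos_of_pos hc α).ne'
  field_simp

lemma indep_surv {Ω : Type*} [MeasureSpace Ω] [IsProbabilityMeasure (ℙ : Measure Ω)]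
    {V E : Ω → ℝ} (hV : Measurable V) (hE : Measurable E) (hi : IndepFun V E ℙ) (s t : ℝ) :
    (ℙ : Measure Ω).real ({ω | s < V ω} ∩ {ω | t < E ω}) = surv V s * surv E t := by
  rw [surv_eq_s6 hV, surv_eq_s6 hE]
  have := hi.measure_inter_preimage_eq_mul (Ioi s) (Ioi t) measurableSet_Ioi measurableSet_Ioi
  simp only [Measure.real, ← ENNReal.toReal_mul]
  exact congrArg ENNReal.toReal this

lemma surv_sum_le {Ω : Type*} [MeasureSpace Ω] [IsProbabilityMeasure (ℙ : Measure Ω)]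
    {V E X : Ω → ℝ} (hV : Measurable V) (hE : Measurable E) (hi : IndepFun V E ℙ)
    (hX : ∀ ω, X ω = V ω + E ω) (δ x : ℝ) :
    surv X x ≤ surv V ((1 - δ) * x) + surv E ((1 - δ) * x)
      + surv V (δ * x) * surv E (δ * x) := by
  have hXm : Measurable X := by
    rw [show X = fun ω => V ω + E ω from funext hX]; exact hV.add hE
  rw [← indep_surv hV hE hi, surv_eq_s6 hXm, surv_eq_s6 hV, surv_eq_s6 hE]
  refine (measureReal_mono ?_).trans ((measureReal_union_le
    ({ω | (1 - δ) * x < V ω} ∪ {ω | (1 - δ) * x < E ω}) _).trans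
    (add_le_add_left (measureReal_union_le _ _) _))
  intro ω hω
  simp only [mem_setOf_eq, hX, mem_union, mem_inter_iff] at hω ⊢
  by_contra! hcon
  obtain ⟨⟨h1, h2⟩, h3⟩ := hcon
  linarith [h3 (by linarith)]

lemma surv_sum_ge {Ω : Type*} [MeasureSpace Ω] [IsProbabilityMeasure (ℙ : Measure Ω)]
    {V E X : Ω → ℝ} (hV : Measurable V) (hE : Measurable E) (hi : IndepFun V E ℙ)
    (hX : ∀ ω, X ω = V ω + E ω) (δ x : ℝ) :
    surv V ((1 + δ) * x) * surv E (-δ * x) + surv V (-δ * x) * surv E ((1 + δ) * x)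
      - surv V ((1 + δ) * x) * surv E ((1 + δ) * x) ≤ surv X x := by
  have hXm : Measurable X := by
    rw [show X = fun ω => V ω + E ω from funext hX]; exact hV.add hE
  simp only [← indep_surv hV hE hi]
  rw [surv_eq_s6 hXm]
  set A := {ω | (1 + δ) * x < V ω} ∩ {ω | -δ * x < E ω}
  set B := {ω | -δ * x < V ω} ∩ {ω | (1 + δ) * x < E ω} with hB
  have hBm : MeasurableSet B :=
    (measurableSet_lt measurable_const hV).inter (measurableSet_lt measurable_const hE)
  have h1 := measureReal_union_add_inter (μ := (ℙ : Measure Ω)) (s := A) hBm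
  have h2 : (ℙ : Measure Ω).real (A ∩ B) ≤
      (ℙ : Measure Ω).real ({ω | (1 + δ) * x < V ω} ∩ {ω | (1 + δ) * x < E ω}) :=
    measureReal_mono fun ω h => ⟨h.1.1, h.2.2⟩
  have h3 : (ℙ : Measure Ω).real (A ∪ B) ≤ (ℙ : Measure Ω).real {ω | x < X ω} := by
    refine measureReal_mono ?_
    rintro ω (⟨h, h'⟩ | ⟨h, h'⟩) <;> simp only [mem_setOf_eq, hX] at h h' ⊢ <;> linarith
  linarith

lemma tail_sum {Ω : Type*} [MeasureSpace Ω] [IsProbabilityMeasure (ℙ : Measure Ω)]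
    {V E X : Ω → ℝ} (hV : Measurable V) (hE : Measurable E) (hi : IndepFun V E ℙ)
    (hX : ∀ ω, X ω = V ω + E ω) {α a b : ℝ}
    (ha : Tendsto (fun y : ℝ => y ^ α * surv V y) atTop (𝓝 a))
    (hb : Tendsto (fun y : ℝ => y ^ α * surv E y) atTop (𝓝 b)) :
    Tendsto (fun x : ℝ => x ^ α * surv X x) atTop (𝓝 (a + b)) := by
  have top : ∀ {c : ℝ}, 0 < c → Tendsto (fun x : ℝ => c * x) atTop atTop :=
    fun hc => tendsto_id.const_mul_atTop hc
  have cont : ∀ g : ℝ → ℝ, Continuous g → g 0 = 1 →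
      Tendsto (fun δ : ℝ => g δ ^ (-α) * a + g δ ^ (-α) * b) (𝓝[>] 0) (𝓝 (a + b)) := by
    intro g hg h0
    have h1 : ContinuousAt (fun δ : ℝ => g δ ^ (-α) * a + g δ ^ (-α) * b) 0 := by
      have : ContinuousAt (fun δ : ℝ => g δ ^ (-α)) 0 :=
        hg.continuousAt.rpow_const (Or.inl (by simp [h0]))
      exact (this.mul_const a).add (this.mul_const b)
    have h2 := h1.tendsto.mono_left (nhdsWithin_le_nhds (s := Ioi 0))
    simpa [h0] using h2
  refine tendsto_order.2 ⟨fun l hl => ?_, fun u hu => ?_⟩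
  · obtain ⟨δ, hδl, hδ⟩ := (((tendsto_order.1 (cont (fun δ => 1 + δ) (by fun_prop)
      (by simp))).1 l hl).and self_mem_nhdsWithin).exists
    have hδ : 0 < δ := hδ
    have h1 : 0 < 1 + δ := by linarith
    have bot : Tendsto (fun x : ℝ => -δ * x) atTop atBot :=
      tendsto_id.const_mul_atTop_of_neg (by linarith)
    have lim := (((tail_scale h1 ha).mul ((surv_bot hE).comp bot)).add
      ((tail_scale h1 hb).mul ((surv_bot hV).comp bot))).sub
      ((tail_scale h1 ha).mul ((surv_top hE).comp (top h1)))
    rw [mul_one, mul_one, mul_zero, sub_zero] at lim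
    filter_upwards [(tendsto_order.1 lim).1 l hδl, eventually_gt_atTop 0] with x hx hx0
    refine hx.trans_le ?_
    have := mul_le_mul_of_nonneg_left (surv_sum_ge hV hE hi hX δ x)
      (Real.rpow_nonneg hx0.le α)
    refine le_trans (le_of_eq ?_) this
    simp only [Function.comp]
    ring
  · obtain ⟨δ, ⟨hδl, hδ⟩, hδ1⟩ := ((((tendsto_order.1 (cont (fun δ => 1 - δ) (by fun_prop)
      (by simp))).2 u hu).and self_mem_nhdsWithin).and
      (nhdsWithin_le_nhds (Iio_mem_nhds (zero_lt_one (α := ℝ))))).exists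
    have hδ : 0 < δ := hδ
    have hδ1 : δ < 1 := hδ1
    have h1 : 0 < 1 - δ := by linarith
    have lim := ((tail_scale h1 ha).add (tail_scale h1 hb)).add
      ((tail_scale hδ ha).mul ((surv_top hE).comp (top hδ)))
    rw [mul_zero, add_zero] at lim
    filter_upwards [(tendsto_order.1 lim).2 u hδl, eventually_gt_atTop 0] with x hx hx0
    refine lt_of_le_of_lt ?_ hx
    have := mul_le_mul_of_nonneg_left (surv_sum_le hV hE hi hX δ x)
      (Real.rpow_nonneg hx0.le α)
    refine this.trans (le_of_eq ?_)
    simp only [Function.comp]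
    ring

/-- Feller's tail-additivity: if `Y` and `ε` are independent with asymptotically
Pareto tails of the same index `α`, then `F̄_X(x) ∼ x^{-α}·(β^α·C₁ + C₂)`. -/
theorem tail_additivity_factor_model
    {Ω : Type*} [MeasureSpace Ω] [IsProbabilityMeasure (ℙ : Measure Ω)]
    (Y ε X : Ω → ℝ) (hYm : Measurable Y) (hεm : Measurable ε)
    (hindep : IndepFun Y ε ℙ)
    (β : ℝ) (hβ : 0 < β)
    (hXdef : ∀ ω, X ω = β * Y ω + ε ω)
    (α : ℝ) (hα : 0 < α)
    (C₁ C₂ : ℝ) (hC₁ : 0 < C₁) (hC₂ : 0 < C₂)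
    (hY : Tendsto (fun y : ℝ => y ^ α * surv Y y) atTop (𝓝 C₁))
    (hε : Tendsto (fun e : ℝ => e ^ α * surv ε e) atTop (𝓝 C₂)) :
    Tendsto (fun x : ℝ => x ^ α * surv X x) atTop (𝓝 (β ^ α * C₁ + C₂)) := by
  have hVm : Measurable (fun ω => β * Y ω) := hYm.const_mul β
  have hi : IndepFun (fun ω => β * Y ω) ε ℙ :=
    hindep.comp (φ := fun y => β * y) (ψ := id) (measurable_const_mul β) measurable_id
  have hV : Tendsto (fun y : ℝ => y ^ α * surv (fun ω => β * Y ω) y) atTop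
      (𝓝 (β ^ α * C₁)) := by
    have h := tail_scale (inv_pos.2 hβ) hY
    rw [Real.inv_rpow hβ.le, Real.rpow_neg hβ.le, inv_inv] at h
    refine h.congr fun x => ?_
    congr 1
    rw [surv_eq_s6 hYm, surv_eq_s6 hVm]
    congr 1
    ext ω
    exact inv_mul_lt_iff₀ hβ
  exact tail_sum hVm hεm hi hXdef hV hε
end

section
/- Let Y and ε be independent real random variables on a probability space (Ω, 𝒜, ℙ), let β > 0 and set X = β·Y + ε. Assume: Y has a probability density P_Y with F_Y(y) < 1 and F_X(x) < 1 for all y, x; sup_{y > 0} y·P_Y(y)/F̄_Y(y) < ∞; for every x ≥ 1, lim_{t→∞} t·P_Y(t·x)/F̄_Y(t) = α_Y·x^{−(α_Y+1)}; there exist t₀ > 0, δ > 0, A > 0 with F̄_Y(t·x)/F̄_Y(t) ≤ A·x^{−δ} for all t ≥ t₀, x ≥ 1; and there exist constants C_Y > 0, C_ε > 0 and tail indices α_Y > α_ε > 0 such that y^{α_Y}·F̄_Y(y) → C_Y and e^{α_ε}·F̄_ε(e) → C_ε as y, e → ∞ (so the idiosyncratic noise ε has a strictly fatter upper tail than the factor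 Y). Then the coefficient of upper tail dependence of (X, Y) vanishes: lim_{u→1⁻} ℙ(X > F_X⁻¹(u) | Y > F_Y⁻¹(u)) = 0. -/
open MeasureTheory ProbabilityTheory Filter Set Topology

section Aux
variable {Ω : Type*} [MeasureSpace Ω] [IsProbabilityMeasure (ℙ : Measure Ω)]

lemma cdf'_eq_aux {Z : Ω → ℝ} (hZ : Measurable Z) (z : ℝ) :
    cdf' Z z = cdf (Measure.map Z ℙ) z := by
  have : IsProbabilityMeasure (Measure.map Z (ℙ : Measure Ω)) :=
    Measure.isProbabilityMeasure_map hZ.aemeasurable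
  rw [cdf_eq_real, measureReal_def, Measure.map_apply hZ measurableSet_Iic]
  rfl

lemma surv_eq_aux {Z : Ω → ℝ} (hZ : Measurable Z) (z : ℝ) :
    surv Z z = (ℙ {ω | z < Z ω}).toReal := by
  have h : {ω | z < Z ω} = {ω | Z ω ≤ z}ᶜ := by ext; simp
  rw [h, surv, cdf']
  exact (probReal_compl_eq_one_sub (measurableSet_le hZ measurable_const)).symm

lemma surv_tendsto_aux {Z : Ω → ℝ} (hZ : Measurable Z) :
    Tendsto (surv Z) atTop (𝓝 0) := by
  have h := (tendsto_cdf_atTop (Measure.map Z (ℙ : Measure Ω))).const_sub 1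
  simp only [sub_self] at h
  refine h.congr fun z => ?_
  rw [surv, cdf'_eq_aux hZ]

lemma quant_nonempty_aux {Z : Ω → ℝ} (hZ : Measurable Z) {u : ℝ} (hu : u < 1) :
    {z : ℝ | u ≤ cdf' Z z}.Nonempty := by
  have h := tendsto_cdf_atTop (Measure.map Z (ℙ : Measure Ω))
  obtain ⟨z, hz⟩ := (h.eventually (lt_mem_nhds hu)).exists
  exact ⟨z, by rw [mem_ofPred_eq, cdf'_eq_aux hZ]; exact hz.le⟩

lemma quant_bdd_aux {Z : Ω → ℝ} (hZ : Measurable Z) {u : ℝ} (hu : 0 < u) :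
    BddBelow {z : ℝ | u ≤ cdf' Z z} := by
  have h := tendsto_cdf_atBot (Measure.map Z (ℙ : Measure Ω))
  obtain ⟨z, hz⟩ := (h.eventually (gt_mem_nhds hu)).exists
  refine ⟨z, fun y hy => ?_⟩
  rw [mem_ofPred_eq, cdf'_eq_aux hZ] at hy
  by_contra! hlt
  have := monotone_cdf (Measure.map Z (ℙ : Measure Ω)) hlt.le
  linarith

lemma quant_tendsto_aux {Z : Ω → ℝ} (hZ : Measurable Z) (hF : ∀ z, cdf' Z z < 1) :
    Tendsto (quant Z) (𝓝[<] (1:ℝ)) atTop := by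
  refine tendsto_atTop.2 fun K => ?_
  filter_upwards [Ioo_mem_nhdsLT (hF K)] with u hu
  refine le_csInf (quant_nonempty_aux hZ hu.2) fun z hz => ?_
  by_contra! hlt
  have := monotone_cdf (Measure.map Z (ℙ : Measure Ω)) hlt.le
  rw [← cdf'_eq_aux hZ, ← cdf'_eq_aux hZ] at this
  have h1 := hu.1
  rw [mem_ofPred_eq] at hz
  linarith

lemma surv_quant_le_aux {Z : Ω → ℝ} (hZ : Measurable Z) {u : ℝ} (hu0 : 0 < u) (hu : u < 1) :
    surv Z (quant Z u) ≤ 1 - u := by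
  have hc : ContinuousWithinAt (cdf (Measure.map Z (ℙ : Measure Ω))) (Ioi (quant Z u))
    (quant Z u) := ((cdf (Measure.map Z (ℙ : Measure Ω))).right_continuous _).mono Ioi_subset_Ici_self
  have : u ≤ cdf (Measure.map Z (ℙ : Measure Ω)) (quant Z u) := by
    refine ge_of_tendsto hc.tendsto ?_
    filter_upwards [self_mem_nhdsWithin] with y hy
    obtain ⟨z, hz, hzy⟩ := exists_lt_of_csInf_lt (quant_nonempty_aux hZ hu) hy
    rw [mem_ofPred_eq, cdf'_eq_aux hZ] at hz
    exact hz.trans (monotone_cdf _ hzy.le)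
  rw [surv, cdf'_eq_aux hZ]; linarith

lemma le_surv_quant_aux {Z : Ω → ℝ} (hZ : Measurable Z) (hna : ∀ z, ℙ {ω | Z ω = z} = 0)
    {u : ℝ} (hu0 : 0 < u) :
    1 - u ≤ surv Z (quant Z u) := by
  have hP : IsProbabilityMeasure (Measure.map Z (ℙ : Measure Ω)) :=
    Measure.isProbabilityMeasure_map hZ.aemeasurable
  set q := quant Z u with hq
  have h0 : Measure.map Z (ℙ : Measure Ω) {q} = 0 := by
    rw [Measure.map_apply hZ (measurableSet_singleton q)]; exact hna q
  have hl : Function.leftLim (cdf (Measure.map Z (ℙ : Measure Ω))) q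
      = cdf (Measure.map Z (ℙ : Measure Ω)) q := by
    have h1 := (cdf (Measure.map Z (ℙ : Measure Ω))).measure_singleton q
    rw [measure_cdf, h0] at h1
    have h2 := ENNReal.ofReal_eq_zero.1 h1.symm
    have h3 := (monotone_cdf (Measure.map Z (ℙ : Measure Ω))).leftLim_le (le_refl q)
    linarith
  have h4 : cdf (Measure.map Z (ℙ : Measure Ω)) q ≤ u := by
    rw [← hl]
    refine le_of_tendsto ((monotone_cdf (Measure.map Z (ℙ : Measure Ω))).tendsto_leftLim q) ?_
    filter_upwards [self_mem_nhdsWithin] with y hy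
    have := notMem_of_lt_csInf hy (quant_bdd_aux hZ hu0)
    rw [mem_ofPred_eq, cdf'_eq_aux hZ, not_le] at this
    exact this.le
  rw [surv, cdf'_eq_aux hZ]; linarith

end Aux

lemma ratio_tendsto_aux (f g : ℝ → ℝ) (a b c C D : ℝ) (hab : b < a) (hc : 0 < c) (hD : 0 < D)
    (hf : Tendsto (fun y : ℝ => y ^ a * f y) atTop (𝓝 C))
    (hg : Tendsto (fun y : ℝ => y ^ b * g y) atTop (𝓝 D)) :
    Tendsto (fun q => f (c * q) / g q) atTop (𝓝 0) := by
  have h1 : Tendsto (fun q : ℝ => c * q) atTop atTop := tendsto_id.const_mul_atTop hc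
  have h2 := ((hf.comp h1).div hg hD.ne').mul
    ((tendsto_rpow_neg_atTop (sub_pos.2 hab)).const_mul (c ^ (-a)))
  simp only [mul_zero] at h2
  refine h2.congr' ?_
  filter_upwards [eventually_gt_atTop 0] with q hq
  simp only [Function.comp, Pi.div_apply]
  rw [Real.mul_rpow hc.le hq.le, Real.rpow_neg hc.le, neg_sub, Real.rpow_sub hq]
  have := (Real.rpow_pos_of_pos hc a).ne'
  have := (Real.rpow_pos_of_pos hq a).ne'
  have := (Real.rpow_pos_of_pos hq b).ne'
  field_simp

/-- When the idiosyncratic noise `ε` has a strictly fatter upper tail than the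
factor `Y` (tail indices `α_Y > α_ε > 0`), the coefficient of upper tail
dependence of `(X, Y)` vanishes. -/
theorem tail_dependence_zero_fatter_noise
    {Ω : Type*} [MeasureSpace Ω] [IsProbabilityMeasure (ℙ : Measure Ω)]
    (Y ε X : Ω → ℝ) (hYm : Measurable Y) (hεm : Measurable ε)
    (hindep : IndepFun Y ε ℙ)
    (β : ℝ) (hβ : 0 < β)
    (hXdef : ∀ ω, X ω = β * Y ω + ε ω)
    (hFY : ∀ y : ℝ, cdf' Y y < 1) (hFX : ∀ x : ℝ, cdf' X x < 1)
    (P_Y : ℝ → ℝ) (hPm : Measurable P_Y) (hPnn : ∀ y, 0 ≤ P_Y y)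
    (hdens : Measure.map Y ℙ
      = (volume : Measure ℝ).withDensity (fun y => ENNReal.ofReal (P_Y y)))
    (hbdd : ∃ M : ℝ, ∀ y > (0:ℝ), y * P_Y y / surv Y y ≤ M)
    (α_Y α_ε : ℝ) (hαε : 0 < α_ε) (hαY : α_ε < α_Y)
    (hH1 : ∀ x ≥ (1:ℝ), Tendsto (fun t => t * P_Y (t * x) / surv Y t) atTop
      (𝓝 (α_Y * x ^ (-(α_Y + 1)))))
    (hH2 : ∃ t₀ > (0:ℝ), ∃ δ > (0:ℝ), ∃ A > (0:ℝ),
      ∀ t ≥ t₀, ∀ x ≥ (1:ℝ), surv Y (t * x) / surv Y t ≤ A * x ^ (-δ))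
    (C_Y C_ε : ℝ) (hCY : 0 < C_Y) (hCε : 0 < C_ε)
    (htailY : Tendsto (fun y : ℝ => y ^ α_Y * surv Y y) atTop (𝓝 C_Y))
    (htailε : Tendsto (fun e : ℝ => e ^ α_ε * surv ε e) atTop (𝓝 C_ε)) :
    Tendsto (fun u => condP {ω | quant X u < X ω} {ω | quant Y u < Y ω})
      (𝓝[<] (1:ℝ)) (𝓝 0) := by
  have hXm : Measurable X := by
    have : X = fun ω => β * Y ω + ε ω := funext hXdef
    rw [this]; fun_prop
  have hna : ∀ z, ℙ {ω | Y ω = z} = 0 := by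
    intro z
    have h : Measure.map Y ℙ {z} = 0 := by
      rw [hdens]; exact withDensity_absolutelyContinuous _ _ (by simp)
    rwa [Measure.map_apply hYm (measurableSet_singleton z)] at h
  have hsY : ∀ y, 0 < surv Y y := fun y => sub_pos.2 (hFY y)
  have hsX : ∀ y, 0 < surv X y := fun y => sub_pos.2 (hFX y)
  have hind : ∀ a b, (ℙ ({ω | a < Y ω} ∩ {ω | b < ε ω})).toReal = surv Y a * surv ε b := by
    intro a b
    rw [surv_eq_aux hYm, surv_eq_aux hεm, ← ENNReal.toReal_mul]
    congr 1
    exact hindep.measure_inter_preimage_eq_mul (Ioi a) (Ioi b) measurableSet_Ioi measurableSet_Ioi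
  have hc : 0 < 1 / (2 * β) := by positivity
  -- lower bound on the tail of X
  have hlow : ∀ q, surv Y 0 * surv ε q ≤ surv X q := by
    intro q
    rw [← hind, surv_eq_aux hXm]
    refine ENNReal.toReal_mono (measure_ne_top _ _) (measure_mono ?_)
    rintro ω ⟨h1, h2⟩
    simp only [mem_ofPred_eq] at *
    rw [hXdef]
    have := mul_pos hβ h1
    linarith
  have hεpos : ∀ᶠ q in atTop, 0 < surv ε q := by
    filter_upwards [htailε.eventually (lt_mem_nhds hCε), eventually_gt_atTop 0] with q h1 h2
    exact pos_of_mul_pos_right h1 (Real.rpow_nonneg h2.le _)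
  have hrat : Tendsto (fun q => surv Y (1 / (2 * β) * q) / surv X q) atTop (𝓝 0) := by
    have h := (ratio_tendsto_aux (surv Y) (surv ε) α_Y α_ε _ C_Y C_ε hαY hc hCε htailY
      htailε).const_mul (1 / surv Y 0)
    rw [mul_zero] at h
    refine tendsto_of_tendsto_of_tendsto_of_le_of_le' tendsto_const_nhds h ?_ ?_
    · exact Eventually.of_forall fun q => (div_pos (hsY _) (hsX _)).le
    · filter_upwards [hεpos] with q hq
      have h0 := hsY 0
      rw [div_mul_div_comm, one_mul]
      exact div_le_div_of_nonneg_left (hsY _).le (by positivity) (hlow q)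
  have hε2 : Tendsto (fun q => surv ε (q / 2)) atTop (𝓝 0) :=
    (surv_tendsto_aux hεm).comp (tendsto_id.atTop_div_const (by norm_num))
  have hsum := (hrat.add hε2).comp (quant_tendsto_aux hXm hFX)
  rw [add_zero] at hsum
  refine tendsto_of_tendsto_of_tendsto_of_le_of_le' tendsto_const_nhds hsum ?_ ?_
  · exact Eventually.of_forall fun u => div_nonneg ENNReal.toReal_nonneg ENNReal.toReal_nonneg
  filter_upwards [Ioo_mem_nhdsLT (zero_lt_one (α := ℝ))] with u hu
  have hX := surv_quant_le_aux hXm hu.1 hu.2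
  have hY := le_surv_quant_aux hYm hna hu.1
  simp only [Function.comp]
  set q := quant X u
  set p := quant Y u
  have hnum : (ℙ ({ω | q < X ω} ∩ {ω | p < Y ω})).toReal
      ≤ surv Y (1 / (2 * β) * q) + surv Y p * surv ε (q / 2) := by
    rw [← hind, surv_eq_aux hYm, ← ENNReal.toReal_add (measure_ne_top _ _) (measure_ne_top _ _)]
    refine ENNReal.toReal_mono (by finiteness) ((measure_mono ?_).trans (measure_union_le _ _))
    rintro ω ⟨h1, h2⟩
    simp only [mem_ofPred_eq, mem_union, mem_inter_iff] at *
    by_cases h : 1 / (2 * β) * q < Y ω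
    · exact Or.inl h
    · refine Or.inr ⟨h2, ?_⟩
      have h3 := mul_le_mul_of_nonneg_left (not_lt.1 h) hβ.le
      have h4 : β * (1 / (2 * β) * q) = q / 2 := by field_simp
      rw [hXdef] at h1
      linarith
  rw [condP, ← surv_eq_aux hYm]
  have hp := hsY p
  calc _ ≤ (surv Y (1 / (2 * β) * q) + surv Y p * surv ε (q / 2)) / surv Y p := by gcongr
    _ = surv Y (1 / (2 * β) * q) / surv Y p + surv ε (q / 2) := by field_simp
    _ ≤ _ := by
      exact add_le_add (div_le_div_of_nonneg_left (hsY _).le (hsX _) (hX.trans hY)) le_rfl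
end
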